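/- For every dimension d ≥ 1, bandwidths 0 < σ ≤ τ, points η_1, …, η_M ∈ ℝ^d and weights w ∈ ℝ^M, the quadratic form of the Gaussian density kernel is monotonically non-increasing in the bandwidth: ∑_{a=1}^M ∑_{b=1}^M w_a w_b k_τ(η_a, η_b) ≤ ∑_{a=1}^M ∑_{b=1}^M w_a w_b k_σ(η_a, η_b). -/

import Mathlib

open scoped BigOperators

/-- The Gaussian density kernel on `ℝ^d` with bandwidth `σ`:
`k_σ(y, y') = (2πσ²)^(-d/2) · exp(−‖y − y'‖² / (2σ²))`. -/
noncomputable def gaussKernel (d : ℕ) (σ : ℝ) (y y' : EuclideanSpace ℝ (Fin d)) : ℝ :=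
  (2 * Real.pi * σ ^ 2) ^ (-(d : ℝ) / 2) * Real.exp (-‖y - y'‖ ^ 2 / (2 * σ ^ 2))

open MeasureTheory

section GaussianCosine

variable {V : Type*} [NormedAddCommGroup V] [InnerProductSpace ℝ V]

theorem re_cexp_neg_mul_sq_norm_add_I_mul_inner (b : ℝ) (w v : V) :
    (Complex.exp (-(b : ℂ) * (‖v‖ : ℂ) ^ 2 + Complex.I * (inner ℝ w v : ℝ))).re =
      Real.exp (-b * ‖v‖ ^ 2) * Real.cos (inner ℝ w v) := by
  rw [Complex.exp_re]
  congr 2 <;> simp [← Complex.ofReal_pow]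

variable [FiniteDimensional ℝ V] [MeasurableSpace V] [BorelSpace V]

theorem integrable_rexp_neg_mul_sq_norm_mul_cos_inner {b : ℝ} (hb : 0 < b) (w : V) :
    Integrable (fun v : V ↦ Real.exp (-b * ‖v‖ ^ 2) * Real.cos (inner ℝ w v)) := by
  have h := (GaussianFourier.integrable_cexp_neg_mul_sq_norm_add (V := V)
    (show 0 < (b : ℂ).re from hb) Complex.I w).re
  refine h.congr (Filter.Eventually.of_forall fun v ↦ ?_)
  exact re_cexp_neg_mul_sq_norm_add_I_mul_inner b w v

theorem integral_rexp_neg_mul_sq_norm_mul_cos_inner {b : ℝ} (hb : 0 < b) (w : V) :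
    ∫ v : V, Real.exp (-b * ‖v‖ ^ 2) * Real.cos (inner ℝ w v) =
      (Real.pi / b) ^ (Module.finrank ℝ V / 2 : ℝ) * Real.exp (-‖w‖ ^ 2 / (4 * b)) := by
  have hb' : 0 < (b : ℂ).re := hb
  have h := Complex.reCLM.integral_comp_comm
    (GaussianFourier.integrable_cexp_neg_mul_sq_norm_add (V := V) hb' Complex.I w)
  simp only [Complex.reCLM_apply, re_cexp_neg_mul_sq_norm_add_I_mul_inner] at h
  rw [h, GaussianFourier.integral_cexp_neg_mul_sq_norm_add hb', Complex.I_sq]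
  rw [← Complex.ofReal_re ((Real.pi / b) ^ (Module.finrank ℝ V / 2 : ℝ) *
    Real.exp (-‖w‖ ^ 2 / (4 * b)))]
  rw [Complex.ofReal_mul, Complex.ofReal_cpow (by positivity)]
  push_cast
  rw [neg_one_mul]

end GaussianCosine

theorem gaussKernel_eq_integral (d : ℕ) {σ : ℝ} (hσ : 0 < σ) (y y' : EuclideanSpace ℝ (Fin d)) :
    gaussKernel d σ y y' = (2 * Real.pi) ^ (-(d : ℝ)) *
      ∫ v : EuclideanSpace ℝ (Fin d),
        Real.exp (-(σ ^ 2 / 2) * ‖v‖ ^ 2) * Real.cos (inner ℝ (y - y') v) := by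
  have hπ := Real.pi_pos
  rw [integral_rexp_neg_mul_sq_norm_mul_cos_inner (by positivity), finrank_euclideanSpace_fin,
    gaussKernel, ← mul_assoc]
  congr 1
  · have h : Real.pi / (σ ^ 2 / 2) = (2 * Real.pi) ^ (2 : ℝ) * (2 * Real.pi * σ ^ 2)⁻¹ := by
      rw [Real.rpow_two]
      field_simp
    rw [h, Real.mul_rpow (x := (2 * Real.pi) ^ (2 : ℝ)) (by positivity) (by positivity),
      ← Real.rpow_mul (by positivity), ← mul_assoc, ← Real.rpow_add (by positivity),
      Real.inv_rpow (by positivity), ← Real.rpow_neg (by positivity)]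
    ring_nf
    simp
  · congr 2
    ring

theorem sum_mul_cos_inner_sub_nonneg {V ι : Type*} [NormedAddCommGroup V] [InnerProductSpace ℝ V]
    [Fintype ι] (η : ι → V) (w : ι → ℝ) (v : V) :
    0 ≤ ∑ a, ∑ b, w a * w b * Real.cos (inner ℝ (η a - η b) v) := by
  have h : ∑ a, ∑ b, w a * w b * Real.cos (inner ℝ (η a - η b) v) =
      (∑ a, w a * Real.cos (inner ℝ (η a) v)) ^ 2 +
        (∑ a, w a * Real.sin (inner ℝ (η a) v)) ^ 2 := by
    simp only [sq, Finset.sum_mul_sum, ← Finset.sum_add_distrib, inner_sub_left, Real.cos_sub]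
    refine Finset.sum_congr rfl fun a _ ↦ Finset.sum_congr rfl fun b _ ↦ ?_
    ring
  rw [h]
  positivity

theorem integrable_rexp_mul_sum_cos_inner_sub {V ι : Type*} [NormedAddCommGroup V]
    [InnerProductSpace ℝ V] [FiniteDimensional ℝ V] [MeasurableSpace V] [BorelSpace V] [Fintype ι]
    {b : ℝ} (hb : 0 < b) (η : ι → V) (w : ι → ℝ) :
    Integrable (fun v : V ↦ Real.exp (-b * ‖v‖ ^ 2) *
      ∑ i, ∑ j, w i * w j * Real.cos (inner ℝ (η i - η j) v)) := by
  simp only [Finset.mul_sum, mul_left_comm (Real.exp _)]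
  exact integrable_finsetSum _ fun i _ ↦ integrable_finsetSum _ fun j _ ↦
    (integrable_rexp_neg_mul_sq_norm_mul_cos_inner hb (η i - η j)).const_mul _

theorem sum_gaussKernel_eq_integral (d : ℕ) {σ : ℝ} (hσ : 0 < σ) {ι : Type*} [Fintype ι]
    (η : ι → EuclideanSpace ℝ (Fin d)) (w : ι → ℝ) :
    ∑ a, ∑ b, w a * w b * gaussKernel d σ (η a) (η b) = (2 * Real.pi) ^ (-(d : ℝ)) *
      ∫ v : EuclideanSpace ℝ (Fin d), Real.exp (-(σ ^ 2 / 2) * ‖v‖ ^ 2) *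
        ∑ a, ∑ b, w a * w b * Real.cos (inner ℝ (η a - η b) v) := by
  have hint (a b : ι) := (integrable_rexp_neg_mul_sq_norm_mul_cos_inner
    (show 0 < σ ^ 2 / 2 by positivity) (η a - η b)).const_mul (w a * w b)
  simp only [Finset.mul_sum, mul_left_comm (Real.exp _)]
  rw [integral_finsetSum _ fun a _ ↦ integrable_finsetSum _ fun b _ ↦ hint a b, Finset.mul_sum]
  refine Finset.sum_congr rfl fun a _ ↦ ?_
  rw [integral_finsetSum _ fun b _ ↦ hint a b, Finset.mul_sum]
  refine Finset.sum_congr rfl fun b _ ↦ ?_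
  rw [integral_const_mul, gaussKernel_eq_integral d hσ, mul_left_comm]

/-- The Gaussian-kernel quadratic form is non-increasing in the bandwidth:
for `0 < σ ≤ τ`, `∑_{a,b} w_a w_b k_τ(η_a, η_b) ≤ ∑_{a,b} w_a w_b k_σ(η_a, η_b)`. -/
theorem stmt_6 (d : ℕ) (hd : 1 ≤ d) (σ τ : ℝ) (hσ : 0 < σ) (hστ : σ ≤ τ) (M : ℕ)
    (η : Fin M → EuclideanSpace ℝ (Fin d)) (w : Fin M → ℝ) :
    ∑ a : Fin M, ∑ b : Fin M, w a * w b * gaussKernel d τ (η a) (η b) ≤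
      ∑ a : Fin M, ∑ b : Fin M, w a * w b * gaussKernel d σ (η a) (η b) := by
  have hτ : 0 < τ := hσ.trans_le hστ
  have hπ := Real.pi_pos
  rw [sum_gaussKernel_eq_integral d hσ, sum_gaussKernel_eq_integral d hτ]
  refine mul_le_mul_of_nonneg_left (integral_mono
    (integrable_rexp_mul_sum_cos_inner_sub (by positivity) η w)
    (integrable_rexp_mul_sum_cos_inner_sub (by positivity) η w) fun v ↦ ?_) (by positivity)
  refine mul_le_mul_of_nonneg_right ?_ (sum_mul_cos_inner_sub_nonneg η w v)
  gcongr
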